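/- Suppose H is a [3]-graph on n ≥ 69 vertices such that every pair of non-adjacent vertices u, v satisfies d_{∂H}(u) + d_{∂H}(v) ≥ n + 65, and H contains no Hamiltonian Berge cycle. Let C = v_1, e_1, ..., v_ℓ, e_ℓ, v_1 be a longest Berge cycle in H with ℓ ∈ {n−1, n−2}, let u ∈ V(H) − V(C), let U_u ⊆ V(C) be a usable set for u with |U_u| ≥ d_C(u)/6, and let X = {v_{i+1} : v_i ∈ U_u ∩ B_1(C)}, where B_1(C) = {v : (n+65)/2 − 3 ≤ d_C(v) < 3n/4 + 13}. Then for any two distinct vertices v_{i+1}, v_{j+1} ∈ X, |R(v_{i+1}, v_{j+1})| ≥ d_C(v_{i+1}) + d_C(v_{j+1}) − |V(C)| − 6. -/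

import Mathlib

/-- Two vertices are adjacent in the hypergraph with edge set `H`
if some edge contains both of them. -/
def HAdj {V : Type*} (H : Finset (Finset V)) (u v : V) : Prop :=
  u ≠ v ∧ ∃ e ∈ H, u ∈ e ∧ v ∈ e

/-- The degree of `u` in the 2-shadow `∂H`: the number of vertices adjacent to `u`. -/
noncomputable def shadowDeg {V : Type*} (H : Finset (Finset V)) (u : V) : ℕ :=
  {v | HAdj H u v}.ncard

/-- A `[3]`-graph: every edge has exactly 2 or 3 vertices. -/
def IsThreeGraph {V : Type*} (H : Finset (Finset V)) : Prop :=
  ∀ e ∈ H, e.card = 2 ∨ e.card = 3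

/-- A Berge cycle of length `t` in the hypergraph with edge set `H`:
`t` distinct vertices `vtx i` and `t` distinct edges `edge i` (indices mod `t`)
with `{vtx i, vtx (i+1)} ⊆ edge i` for every `i`. -/
structure BergeCycle {V : Type*} (H : Finset (Finset V)) (t : ℕ) where
  vtx : ZMod t → V
  edge : ZMod t → Finset V
  vtx_inj : Function.Injective vtx
  edge_inj : Function.Injective edge
  edge_mem : ∀ i, edge i ∈ H
  mem_fst : ∀ i, vtx i ∈ edge i
  mem_snd : ∀ i, vtx (i + 1) ∈ edge i

/-- `d_C(u)`: the number of vertices of the Berge cycle `C` adjacent to `u`. -/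
noncomputable def BergeCycle.dC {V : Type*} {H : Finset (Finset V)} {t : ℕ}
    (C : BergeCycle H t) (u : V) : ℕ :=
  {v | v ∈ Set.range C.vtx ∧ HAdj H u v}.ncard

/-- `H` contains a Hamiltonian Berge cycle, i.e. a Berge cycle whose
vertex set is all of `V`. -/
def HamiltonianBergeCycle {V : Type*} (H : Finset (Finset V)) : Prop :=
  ∃ (t : ℕ) (C : BergeCycle H t), Set.range C.vtx = Set.univ

/-- A set `U` of indices of vertices of the Berge cycle `C` is usable for `u`:
(1) for every `i ∈ U` there is an edge in `E(u, v_{i-1}) - {e_{i-2}}`;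
(2) any two distinct `i, j ∈ U` are non-consecutive on `C`;
(3) for every pair of distinct `i, j ∈ U` there are distinct edges
`e ∈ E(u, v_{i-1}) - {e_{i-2}}` and `e' ∈ E(u, v_{j-1}) - {e_{j-2}}`. -/
def Usable {V : Type*} {H : Finset (Finset V)} {t : ℕ} (C : BergeCycle H t) (u : V)
    (U : Set (ZMod t)) : Prop :=
  (∀ i ∈ U, ∃ e ∈ H, e ≠ C.edge (i - 2) ∧ u ∈ e ∧ C.vtx (i - 1) ∈ e) ∧
  (∀ i ∈ U, ∀ j ∈ U, i ≠ j → j ≠ i + 1 ∧ j ≠ i - 1) ∧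
  (∀ i ∈ U, ∀ j ∈ U, i ≠ j → ∃ e ∈ H, ∃ e' ∈ H, e ≠ e' ∧
    e ≠ C.edge (i - 2) ∧ u ∈ e ∧ C.vtx (i - 1) ∈ e ∧
    e' ≠ C.edge (j - 2) ∧ u ∈ e' ∧ C.vtx (j - 1) ∈ e')

/-- `CwBtw a b c` : on the cycle oriented clockwise, `b` lies strictly between
`a` and `c` on the clockwise arc from `a` to `c`. -/
def CwBtw {t : ℕ} (a b c : ZMod t) : Prop :=
  0 < (b - a).val ∧ (b - a).val < (c - a).val

/-- `e` is an `(i,j;k)`-bridge of the Berge cycle `C`. -/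
def IsBridge {V : Type*} [DecidableEq V] {H : Finset (Finset V)} {t : ℕ}
    (C : BergeCycle H t) (i j k : ZMod t) (e : Finset V) : Prop :=
  (CwBtw i k j ∧ ((e = C.edge (k + 1) ∧ e = {C.vtx i, C.vtx (k + 1), C.vtx (k + 2)}) ∨
                (e = C.edge (k - 1) ∧ e = {C.vtx j, C.vtx k, C.vtx (k - 1)}))) ∨
  (CwBtw j k i ∧ ((e = C.edge (k - 1) ∧ e = {C.vtx i, C.vtx k, C.vtx (k - 1)}) ∨
                (e = C.edge (k + 1) ∧ e = {C.vtx j, C.vtx (k + 1), C.vtx (k + 2)})))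

/-- `R(v_i, v_j)`: the set of bridges produced by the pair `{v_i, v_j}`,
i.e. all `(i,j;k)`-bridges over `k ∉ {i, j}`. -/
def RBridges {V : Type*} [DecidableEq V] {H : Finset (Finset V)} {t : ℕ}
    (C : BergeCycle H t) (i j : ZMod t) : Set (Finset V) :=
  {e | ∃ k : ZMod t, k ≠ i ∧ k ≠ j ∧ IsBridge C i j k e}

section Aux

open Finset

set_option linter.unusedSectionVars false

variable {V : Type*} [DecidableEq V]

/-- A Berge path with `m` edges, given by functions on `ℕ`. -/
structure BP (H : Finset (Finset V)) (m : ℕ) (p : ℕ → V) (g : ℕ → Finset V) : Prop where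
  pinj : ∀ a b, a ≤ m → b ≤ m → p a = p b → a = b
  ginj : ∀ a b, a < m → b < m → g a = g b → a = b
  gm : ∀ a, a < m → g a ∈ H
  m1 : ∀ a, a < m → p a ∈ g a
  m2 : ∀ a, a < m → p (a + 1) ∈ g a

/-- number of path edges having `v` as an off-path vertex -/
def rho (m : ℕ) (p : ℕ → V) (g : ℕ → Finset V) (v : V) : ℕ :=
  ((range m).filter (fun k => v ∈ g k ∧ v ≠ p k ∧ v ≠ p (k + 1))).card

theorem four_mem {H : Finset (Finset V)} (h3 : IsThreeGraph H) {e : Finset V} (he : e ∈ H)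
    {a b c d : V} (ha : a ∈ e) (hb : b ∈ e) (hc : c ∈ e) (hd : d ∈ e)
    (h1 : a ≠ b) (h2 : a ≠ c) (h4 : a ≠ d) (h5 : b ≠ c) (h6 : b ≠ d) (h7 : c ≠ d) : False := by
  have hs : ({a, b, c, d} : Finset V) ⊆ e := by
    intro x hx
    simp only [mem_insert, mem_singleton] at hx
    rcases hx with rfl | rfl | rfl | rfl <;> assumption
  have hc4 : ({a, b, c, d} : Finset V).card = 4 := by
    rw [card_insert_of_notMem, card_insert_of_notMem, card_insert_of_notMem, card_singleton] <;>
      simp [*]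
  have := card_le_card hs
  rcases h3 e he with h | h <;> omega

theorem BP.rev {H : Finset (Finset V)} {m : ℕ} {p : ℕ → V} {g : ℕ → Finset V}
    (P : BP H m p g) : BP H m (fun a => p (m - a)) (fun a => g (m - 1 - a)) where
  pinj := fun a b ha hb h => by
    have := P.pinj _ _ (by omega) (by omega) h
    omega
  ginj := fun a b ha hb h => by
    have := P.ginj _ _ (by omega) (by omega) h
    omega
  gm := fun a ha => P.gm _ (by omega)
  m1 := fun a ha => by
    have := P.m2 (m - 1 - a) (by omega)
    rwa [show m - 1 - a + 1 = m - a by omega] at this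
  m2 := fun a ha => by
    have := P.m1 (m - 1 - a) (by omega)
    rwa [show m - 1 - a = m - (a + 1) by omega] at *

theorem rho_rev (m : ℕ) (p : ℕ → V) (g : ℕ → Finset V) (v : V) :
    rho m (fun a => p (m - a)) (fun a => g (m - 1 - a)) v = rho m p g v := by
  unfold rho
  apply card_bij' (fun k _ => m - 1 - k) (fun k _ => m - 1 - k)
  · intro k hk
    simp only [mem_filter, mem_range] at hk ⊢
    obtain ⟨h1, h2, h4, h5⟩ := hk
    refine ⟨by omega, h2, ?_, ?_⟩
    · rwa [show m - 1 - k = m - (k + 1) by omega]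
    · rwa [show m - 1 - k + 1 = m - k by omega]
  · intro k hk
    simp only [mem_filter, mem_range] at hk ⊢
    obtain ⟨h1, h2, h4, h5⟩ := hk
    refine ⟨by omega, ?_, ?_, ?_⟩
    · rwa [show m - 1 - (m - 1 - k) = k by omega]
    · rwa [show m - (m - 1 - k) = k + 1 by omega]
    · rwa [show m - (m - 1 - k + 1) = k by omega]
  · intro k hk
    simp only [mem_filter, mem_range] at hk
    omega
  · intro k hk
    simp only [mem_filter, mem_range] at hk
    omega

theorem BP.close {H : Finset (Finset V)} {m : ℕ} {p : ℕ → V} {g : ℕ → Finset V}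
    (P : BP H m p g) {h : Finset V} (hH : h ∈ H) (hg : ∀ a, a < m → h ≠ g a)
    (h0 : p 0 ∈ h) (hm : p m ∈ h) : Nonempty (BergeCycle H (m + 1)) := by
  have hlt : ∀ i : ZMod (m + 1), i.val < m + 1 := fun i => ZMod.val_lt i
  have hsucc : ∀ i : ZMod (m + 1), i.val < m → (i + 1).val = i.val + 1 := by
    intro i hi
    have h1 : (1 : ZMod (m + 1)).val = 1 := by
      have : Fact (1 < m + 1) := ⟨by omega⟩
      exact ZMod.val_one _
    rw [ZMod.val_add_of_lt, h1]
    rw [h1]; omega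
  have hlast : ∀ i : ZMod (m + 1), i.val = m → i + 1 = 0 := by
    intro i hi
    have : ((i.val + 1 : ℕ) : ZMod (m + 1)) = 0 := by
      rw [hi]; exact ZMod.natCast_self _
    simpa using this
  refine ⟨⟨fun i => p i.val, fun i => if i.val = m then h else g i.val, ?_, ?_, ?_, ?_, ?_⟩⟩
  · intro i j hij
    have := P.pinj _ _ (by have := hlt i; omega) (by have := hlt j; omega) hij
    exact ZMod.val_injective _ this
  · intro i j hij
    have hi := hlt i
    have hj := hlt j
    apply ZMod.val_injective
    simp only at hij
    split_ifs at hij with c1 c2 c2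
    · omega
    · exact absurd hij (hg _ (by omega))
    · exact absurd hij.symm (hg _ (by omega))
    · exact P.ginj _ _ (by omega) (by omega) hij
  · intro i
    have hi := hlt i
    split_ifs with c
    · exact hH
    · exact P.gm _ (by omega)
  · intro i
    have hi := hlt i
    split_ifs with c
    · rwa [c]
    · exact P.m1 _ (by omega)
  · intro i
    have hi := hlt i
    split_ifs with c
    · rw [hlast i c]; simpa using h0
    · rw [hsucc i (by omega)]; exact P.m2 _ (by omega)

/-- vertices of the rotated path -/
def rotP (k : ℕ) (p : ℕ → V) : ℕ → V := fun a => if a ≤ k then p (k - a) else p a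

/-- edges of the rotated path -/
def rotG (k : ℕ) (h : Finset V) (g : ℕ → Finset V) : ℕ → Finset V :=
  fun a => if a < k then g (k - 1 - a) else if a = k then h else g a

theorem BP.rot {H : Finset (Finset V)} {m : ℕ} {p : ℕ → V} {g : ℕ → Finset V}
    (P : BP H m p g) {k : ℕ} (hk : k < m) {h : Finset V} (hH : h ∈ H)
    (hg : ∀ l, l < m → l ≠ k → h ≠ g l)
    (h0 : p 0 ∈ h) (hm : p (k + 1) ∈ h) : BP H m (rotP k p) (rotG k h g) where
  pinj := fun a b ha hb hab => by
    unfold rotP at hab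
    split_ifs at hab with c1 c2 c2
    all_goals
      have := P.pinj _ _ (by omega) (by omega) hab
      omega
  ginj := fun a b ha hb hab => by
    unfold rotG at hab
    split_ifs at hab with c1 c2 c3 c2 c3 c4 c4 c5
    · have := P.ginj _ _ (by omega) (by omega) hab
      omega
    · exact absurd hab.symm (hg _ (by omega) (by omega))
    · have := P.ginj _ _ (by omega) (by omega) hab
      omega
    · exact absurd hab (hg _ (by omega) (by omega))
    · omega
    · exact absurd hab (hg _ (by omega) (by omega))
    · have := P.ginj _ _ (by omega) (by omega) hab
      omega
    · exact absurd hab.symm (hg _ (by omega) (by omega))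
    · have := P.ginj _ _ (by omega) (by omega) hab
      omega
  gm := fun a ha => by
    unfold rotG
    split_ifs with c1 c2
    · exact P.gm _ (by omega)
    · exact hH
    · exact P.gm _ (by omega)
  m1 := fun a ha => by
    unfold rotG rotP
    split_ifs with c1 c2 c3 c4 c5
    · have := P.m2 (k - 1 - a) (by omega)
      rwa [show k - 1 - a + 1 = k - a by omega] at this
    · omega
    · subst c3; simpa using h0
    · omega
    · omega
    · exact P.m1 _ ha
  m2 := fun a ha => by
    unfold rotG rotP
    by_cases c1 : a < k
    · rw [if_pos c1, if_pos (by omega)]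
      have := P.m1 (k - 1 - a) (by omega)
      rwa [show k - 1 - a = k - (a + 1) by omega] at *
    · rw [if_neg c1, if_neg (show ¬ a + 1 ≤ k by omega)]
      by_cases c2 : a = k
      · rw [if_pos c2, c2]; exact hm
      · rw [if_neg c2]; exact P.m2 _ ha

theorem rho_rot (m k : ℕ) (p : ℕ → V) (g : ℕ → Finset V) (h : Finset V) (hk : k < m) (v : V) :
    rho m (rotP k p) (rotG k h g) v ≤ rho m p g v + 1 := by
  unfold rho
  refine le_trans (card_le_card_of_injOn (t := insert k ((range m).filter
    (fun k => v ∈ g k ∧ v ≠ p k ∧ v ≠ p (k + 1)))) (fun a => if a < k then k - 1 - a else a)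
    ?_ ?_) (card_insert_le _ _)
  · intro a ha
    simp only [coe_filter, mem_range, Set.mem_ofPred_eq] at ha
    obtain ⟨h1, h2, h4, h5⟩ := ha
    simp only [coe_insert, coe_filter, mem_range, Set.mem_insert_iff, Set.mem_ofPred_eq]
    unfold rotG at h2
    unfold rotP at h4 h5
    by_cases c : a < k
    · rw [if_pos c] at h2 ⊢
      rw [if_pos (by omega)] at h4 h5
      right
      refine ⟨by omega, h2, ?_, ?_⟩
      · rwa [show k - 1 - a = k - (a + 1) by omega]
      · rwa [show k - 1 - a + 1 = k - a by omega]
    · rw [if_neg c] at h2 ⊢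
      by_cases c2 : a = k
      · left; exact c2
      · rw [if_neg c2] at h2
        rw [if_neg (by omega)] at h4 h5
        right
        exact ⟨h1, h2, h4, h5⟩
  · intro a _ b _ hab
    simp only at hab
    split_ifs at hab <;> omega

variable [Fintype V]

open Classical in
/-- admissible rotation indices -/
noncomputable def Aset (H : Finset (Finset V)) (m : ℕ) (p : ℕ → V) (g : ℕ → Finset V) :
    Finset ℕ :=
  (range m).filter (fun k => ∃ h ∈ H, p 0 ∈ h ∧ p (k + 1) ∈ h ∧ ∀ l, l < m → l ≠ k → h ≠ g l)

theorem count_A {H : Finset (Finset V)} (h3 : IsThreeGraph H) {m : ℕ} {p : ℕ → V}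
    {g : ℕ → Finset V} (P : BP H m p g) (hm : 1 ≤ m) :
    shadowDeg H (p 0) + (m + 1) ≤ (Aset H m p g).card + rho m p g (p 0) + 1 + Fintype.card V := by
  classical
  have hpath : ((range (m + 1)).image p).card = m + 1 := by
    rw [card_image_of_injOn, card_range]
    intro a ha b hb hab
    simp only [coe_range, Set.mem_Iio] at ha hb
    exact P.pinj _ _ (by omega) (by omega) hab
  have hcomp : (univ \ (range (m + 1)).image p).card + (m + 1) = Fintype.card V := by
    have := card_sdiff_add_card_eq_card (subset_univ ((range (m + 1)).image p))
    rwa [hpath, card_univ] at this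
  have hg0 : (g 0 \ {p 0, p 1}).card ≤ 1 := by
    rw [card_sdiff_of_subset]
    · have : ({p 0, p 1} : Finset V).card = 2 := by
        rw [card_pair]
        intro h
        have := P.pinj _ _ (by omega) (by omega) h
        omega
      rcases h3 _ (P.gm 0 (by omega)) with h | h <;> omega
    · intro x hx
      simp only [mem_insert, mem_singleton] at hx
      rcases hx with rfl | rfl
      · exact P.m1 0 (by omega)
      · exact P.m2 0 (by omega)
  have hsub : {v | HAdj H (p 0) v} ⊆ (((univ \ (range (m + 1)).image p) ∪
      (Aset H m p g).image (fun k => p (k + 1)) ∪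
      ((range m).filter (fun k => p 0 ∈ g k ∧ p 0 ≠ p k ∧ p 0 ≠ p (k + 1))).image p ∪
      (g 0 \ {p 0, p 1}) : Finset V) : Set V) := by
    rintro v ⟨hne, h, hH, hx, hv⟩
    simp only [mem_coe, mem_union]
    by_cases hvp : v ∈ (range (m + 1)).image p
    swap
    · left; left; left; simp only [mem_sdiff, mem_univ, true_and]; exact hvp
    obtain ⟨a, ha, rfl⟩ := mem_image.1 hvp
    rw [mem_range] at ha
    have ha0 : a ≠ 0 := by rintro rfl; exact hne rfl
    by_cases hA : a - 1 ∈ Aset H m p g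
    · left; left; right
      refine mem_image.2 ⟨a - 1, hA, ?_⟩
      rw [show a - 1 + 1 = a by omega]
    have : ∃ l, l < m ∧ l ≠ a - 1 ∧ h = g l := by
      by_contra hcon
      push Not at hcon
      apply hA
      unfold Aset
      refine mem_filter.2 ⟨mem_range.2 (by omega), h, hH, hx, ?_, hcon⟩
      rwa [show a - 1 + 1 = a by omega]
    obtain ⟨l, hl, hla, rfl⟩ := this
    have ne : ∀ b c, b ≤ m → c ≤ m → b ≠ c → p b ≠ p c := fun b c hb hc hbc h =>
      hbc (P.pinj _ _ hb hc h)
    by_cases hl0 : l = 0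
    · right
      subst hl0
      simp only [mem_sdiff, mem_insert, mem_singleton, not_or]
      exact ⟨hv, ne _ _ (by omega) (by omega) (by omega), ne _ _ (by omega) (by omega) (by omega)⟩
    · left; right
      by_cases hal : a = l
      · subst hal
        refine mem_image.2 ⟨a, mem_filter.2 ⟨mem_range.2 hl, hx, ne _ _ ?_ ?_ ?_, ne _ _ ?_ ?_ ?_⟩, rfl⟩
        all_goals omega
      · exfalso
        refine four_mem h3 hH hx (P.m1 l hl) (P.m2 l hl) hv (ne _ _ ?_ ?_ ?_) (ne _ _ ?_ ?_ ?_)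
          (ne _ _ ?_ ?_ ?_) (ne _ _ ?_ ?_ ?_) (ne _ _ ?_ ?_ ?_) (ne _ _ ?_ ?_ ?_)
        all_goals omega
  have h1 : shadowDeg H (p 0) ≤ _ := Set.ncard_le_ncard hsub (finite_toSet _)
  rw [Set.ncard_coe_finset] at h1
  have h2 := card_union_le ((univ \ (range (m + 1)).image p) ∪
      (Aset H m p g).image (fun k => p (k + 1)) ∪
      ((range m).filter (fun k => p 0 ∈ g k ∧ p 0 ≠ p k ∧ p 0 ≠ p (k + 1))).image p)
      (g 0 \ {p 0, p 1})
  have h4 := card_union_le ((univ \ (range (m + 1)).image p) ∪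
      (Aset H m p g).image (fun k => p (k + 1)))
      (((range m).filter (fun k => p 0 ∈ g k ∧ p 0 ≠ p k ∧ p 0 ≠ p (k + 1))).image p)
  have h5 := card_union_le (univ \ (range (m + 1)).image p)
      ((Aset H m p g).image (fun k => p (k + 1)))
  have h6 := card_image_le (s := Aset H m p g) (f := fun k => p (k + 1))
  have h7 := card_image_le (s := (range m).filter
    (fun k => p 0 ∈ g k ∧ p 0 ≠ p k ∧ p 0 ≠ p (k + 1))) (f := p)
  unfold rho
  omega

theorem count_main {H : Finset (Finset V)} (h3 : IsThreeGraph H) {m : ℕ} {p : ℕ → V}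
    {g : ℕ → Finset V} (P : BP H m p g) (hm : 1 ≤ m) (hN : IsEmpty (BergeCycle H (m + 1))) :
    shadowDeg H (p 0) + shadowDeg H (p m) + m ≤
      2 * Fintype.card V + 2 + rho m p g (p 0) + rho m p g (p m) := by
  classical
  have a1 := count_A h3 P hm
  have a2 := count_A h3 P.rev hm
  rw [rho_rev] at a2
  simp only [Nat.sub_zero] at a2
  set B := Aset H m (fun a => p (m - a)) (fun a => g (m - 1 - a)) with hB
  have hBr : ∀ k ∈ B, k < m := fun k hk => mem_range.1 (mem_filter.1 hk).1
  have hBc : (B.image (fun k => m - 1 - k)).card = B.card := by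
    apply card_image_of_injOn
    intro a ha b hb hab
    have := hBr a ha
    have := hBr b hb
    simp only at hab
    omega
  have hunion : (Aset H m p g ∪ B.image (fun k => m - 1 - k)).card ≤ m := by
    have : Aset H m p g ∪ B.image (fun k => m - 1 - k) ⊆ range m := by
      intro k hk
      rcases mem_union.1 hk with hk | hk
      · exact (mem_filter.1 hk).1
      · obtain ⟨b, hb, rfl⟩ := mem_image.1 hk
        rw [mem_range]; omega
    simpa using card_le_card this
  have hinter : (Aset H m p g ∩ B.image (fun k => m - 1 - k)).card ≤ 2 := by
    have : Aset H m p g ∩ B.image (fun k => m - 1 - k) ⊆ {0, m - 1} := by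
      intro k hk
      obtain ⟨hkA, hkB⟩ := mem_inter.1 hk
      obtain ⟨b, hb, rfl⟩ := mem_image.1 hkB
      have hbm := hBr b hb
      set k := m - 1 - b with hkdef
      by_contra hcon
      simp only [mem_insert, mem_singleton, not_or] at hcon
      obtain ⟨hkm, h, hH, hx, hk1, hg⟩ := mem_filter.1 hkA
      obtain ⟨_, h', hH', hy, hk', hg'⟩ := mem_filter.1 hb
      simp only [Nat.sub_zero] at hy hk'
      rw [show m - (b + 1) = k by omega] at hk'
      have ne : ∀ b c, b ≤ m → c ≤ m → b ≠ c → p b ≠ p c := fun b c hb hc hbc h =>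
        hbc (P.pinj _ _ hb hc h)
      rw [mem_range] at hkm
      have hne : h' ≠ h := by
        rintro rfl
        refine four_mem h3 hH hx hy hk1 hk' (ne _ _ ?_ ?_ ?_) (ne _ _ ?_ ?_ ?_)
          (ne _ _ ?_ ?_ ?_) (ne _ _ ?_ ?_ ?_) (ne _ _ ?_ ?_ ?_) (ne _ _ ?_ ?_ ?_)
        all_goals omega
      have hg'' : ∀ l, l < m → l ≠ k → h' ≠ g l := by
        intro l hl hlk
        have := hg' (m - 1 - l) (by omega) (by omega)
        beta_reduce at this
        rwa [show m - 1 - (m - 1 - l) = l by omega] at this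
      have Q := P.rot hkm hH hg hx hk1
      have := Q.close hH' (by
        intro a ha
        unfold rotG
        split_ifs with c1 c2
        · exact hg'' _ (by omega) (by omega)
        · exact hne
        · exact hg'' _ (by omega) (by omega)) (by simpa [rotP] using hk')
        (by simpa [rotP, show ¬ m ≤ k by omega] using hy)
      exact hN.false this.some
    exact le_trans (card_le_card this) card_le_two
  have := card_union_add_card_inter (Aset H m p g) (B.image (fun k => m - 1 - k))
  omega

theorem adj_ends {H : Finset (Finset V)} (h3 : IsThreeGraph H) {m : ℕ} {p : ℕ → V}
    {g : ℕ → Finset V} (P : BP H m p g) (hm : 1 ≤ m) (hN : IsEmpty (BergeCycle H (m + 1)))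
    (hadj : HAdj H (p 0) (p m)) : p m ∈ g 0 ∨ p 0 ∈ g (m - 1) := by
  obtain ⟨_, h, hH, h0, h1⟩ := hadj
  by_cases hc : ∀ a, a < m → h ≠ g a
  · exact absurd (P.close hH hc h0 h1) (by simpa using hN)
  push Not at hc
  obtain ⟨a, ha, rfl⟩ := hc
  by_cases a0 : a = 0
  · subst a0; left; exact h1
  by_cases am : a = m - 1
  · subst am; right; exact h0
  exfalso
  have ne : ∀ b c, b ≤ m → c ≤ m → b ≠ c → p b ≠ p c := fun b c hb hc hbc h =>
    hbc (P.pinj _ _ hb hc h)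
  refine four_mem h3 hH h0 h1 (P.m1 a ha) (P.m2 a ha) (ne _ _ ?_ ?_ ?_) (ne _ _ ?_ ?_ ?_)
    (ne _ _ ?_ ?_ ?_) (ne _ _ ?_ ?_ ?_) (ne _ _ ?_ ?_ ?_) (ne _ _ ?_ ?_ ?_)
  all_goals omega

theorem double_count {ι κ : Type*} (S : Finset ι) (T : Finset κ) (r : ι → κ → Prop)
    [∀ i, DecidablePred (r i)]
    (huniq : ∀ k ∈ T, ∀ i ∈ S, ∀ j ∈ S, r i k → r j k → i = j) :
    ∑ i ∈ S, (T.filter (r i)).card ≤ T.card := by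
  classical
  have h := sum_card_bipartiteAbove_eq_sum_card_bipartiteBelow (s := S) (t := T) r
  unfold bipartiteAbove bipartiteBelow at h
  have h2 : ∑ i ∈ S, (T.filter (r i)).card = ∑ k ∈ T, (S.filter (fun i => r i k)).card := by
    convert h
  rw [h2]
  refine le_trans (sum_le_card_nsmul _ _ 1 ?_) (by simp)
  intro k hk
  rw [card_le_one]
  intro a ha b hb
  rw [mem_filter] at ha hb
  exact huniq k hk a ha.1 b hb.1 ha.2 hb.2

theorem clique_bound {ι : Type*} [DecidableEq ι] (S : Finset ι) (R : ι → ι → Prop)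
    (h1 : ∀ i ∈ S, ∀ j ∈ S, i ≠ j → R i j ∨ R j i)
    (h2 : ∀ i ∈ S, ∀ j ∈ S, ∀ k ∈ S, i ≠ j → i ≠ k → R i j → R i k → j = k) :
    S.card ≤ 3 := by
  classical
  set X := S.offDiag.filter (fun q => R q.1 q.2) with hX
  have hXc : X.card ≤ S.card := by
    apply card_le_card_of_injOn (fun q => q.1)
    · intro q hq
      have := (mem_filter.1 hq).1
      rw [mem_offDiag] at this
      exact this.1
    · rintro ⟨a, b⟩ hq ⟨c, d⟩ hq' (hac : a = c)
      subst hac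
      have q1 := mem_filter.1 hq
      have q2 := mem_filter.1 hq'
      simp only [mem_offDiag] at q1 q2
      rw [h2 a q1.1.1 b q1.1.2.1 d q2.1.2.1 q1.1.2.2 q2.1.2.2 q1.2 q2.2]
  have hsub : S.offDiag ⊆ X ∪ X.image Prod.swap := by
    rintro ⟨a, b⟩ hq
    have hq' := mem_offDiag.1 hq
    simp only at hq'
    rcases h1 a hq'.1 b hq'.2.1 hq'.2.2 with h | h
    · exact mem_union_left _ (mem_filter.2 ⟨hq, h⟩)
    · refine mem_union_right _ (mem_image.2 ⟨(b, a), mem_filter.2 ⟨?_, h⟩, rfl⟩)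
      exact mem_offDiag.2 ⟨hq'.2.1, hq'.1, hq'.2.2.symm⟩
  have c1 := card_le_card hsub
  have c2 := card_union_le X (X.image Prod.swap)
  have c3 := card_image_le (s := X) (f := Prod.swap)
  rw [offDiag_card] at c1
  by_contra hcon
  have : S.card * 4 ≤ S.card * S.card := Nat.mul_le_mul_left _ (by omega)
  omega

/-- number of cycle edges having `v` as off-cycle-position vertex -/
def rC {H : Finset (Finset V)} {t : ℕ} [NeZero t] (C : BergeCycle H t) (v : V) : ℕ :=
  ((univ : Finset (ZMod t)).filter
    (fun k => v ∈ C.edge k ∧ v ≠ C.vtx k ∧ v ≠ C.vtx (k + 1))).card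

theorem cast_inj' {t a b : ℕ} (ha : 1 ≤ a) (hb : 1 ≤ b) (hat : a ≤ t) (hbt : b ≤ t)
    (h : (a : ZMod t) = b) : a = b := by
  have h' := (ZMod.natCast_eq_natCast_iff a b t).1 h
  rcases le_total a b with hab | hab
  · have := (Nat.modEq_iff_dvd' hab).1 h'
    by_contra hne
    have := Nat.le_of_dvd (by omega) this
    omega
  · have := (Nat.modEq_iff_dvd' hab).1 h'.symm
    by_contra hne
    have := Nat.le_of_dvd (by omega) this
    omega

theorem edge_idx {H : Finset (Finset V)} (h3 : IsThreeGraph H) {t : ℕ} (ht : 2 ≤ t)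
    (C : BergeCycle H t) {u : V} (hu : u ∉ Set.range C.vtx) {a k : ZMod t}
    (h1 : u ∈ C.edge k) (h2 : C.vtx a ∈ C.edge k) : k = a ∨ k = a - 1 := by
  by_contra hcon
  push Not at hcon
  have hne : ∀ b, u ≠ C.vtx b := fun b h => hu ⟨b, h.symm⟩
  have h10 : k ≠ k + 1 := by
    intro h
    have h0 : (1 : ZMod t) = 0 := by
      have : k + 0 = k + 1 := by simpa using h
      exact (add_left_cancel this).symm
    have : Fact (1 < t) := ⟨by omega⟩
    exact one_ne_zero h0
  refine four_mem h3 (C.edge_mem k) h1 h2 (C.mem_fst k) (C.mem_snd k) (hne _) (hne _) (hne _)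
    ?_ ?_ ?_
  · exact fun h => hcon.1 (C.vtx_inj h).symm
  · exact fun h => hcon.2 (by rw [C.vtx_inj h]; ring)
  · exact fun h => h10 (C.vtx_inj h)

/-- vertices of the base path -/
def baseP {H : Finset (Finset V)} {t : ℕ} (C : BergeCycle H t) (u : V) (i : ZMod t) : ℕ → V :=
  fun s => if s = 0 then u else C.vtx (i - (s : ZMod t))

/-- edges of the base path -/
def baseG {H : Finset (Finset V)} {t : ℕ} (C : BergeCycle H t) (f : Finset V) (i : ZMod t) :
    ℕ → Finset V :=
  fun s => if s = 0 then f else C.edge (i - (s : ZMod t) - 1)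

theorem base_path {H : Finset (Finset V)} (h3 : IsThreeGraph H) {t : ℕ} (ht : 2 ≤ t)
    (C : BergeCycle H t) {u : V} (hu : u ∉ Set.range C.vtx) {i : ZMod t} {f : Finset V}
    (hf : f ∈ H) (h1 : u ∈ f) (h2 : C.vtx (i - 1) ∈ f) (h4 : f ≠ C.edge (i - 2)) :
    BP H t (baseP C u i) (baseG C f i) := by
  have hfe : ∀ s, 1 ≤ s → s < t → f ≠ C.edge (i - (s : ZMod t) - 1) := by
    rintro s hs hst rfl
    rcases edge_idx h3 ht C hu h1 h2 with h | h
    · have : (s : ZMod t) = (t : ℕ) := by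
        rw [ZMod.natCast_self]
        linear_combination -h
      have := cast_inj' hs (by omega) (by omega) (le_refl _) this
      omega
    · apply h4
      rw [h]; congr 1; ring
  constructor
  · intro a b ha hb hab
    unfold baseP at hab
    split_ifs at hab with c1 c2 c2
    · omega
    · exact absurd ⟨_, hab.symm⟩ hu
    · exact absurd ⟨_, hab⟩ hu
    · have := C.vtx_inj hab
      exact cast_inj' (by omega) (by omega) ha hb (by linear_combination -this)
  · intro a b ha hb hab
    unfold baseG at hab
    split_ifs at hab with c1 c2 c2
    · omega
    · exact absurd hab (hfe _ (by omega) (by omega))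
    · exact absurd hab.symm (hfe _ (by omega) (by omega))
    · have := C.edge_inj hab
      exact cast_inj' (by omega) (by omega) ha.le hb.le (by linear_combination -this)
  · intro a ha
    unfold baseG
    split_ifs
    · exact hf
    · exact C.edge_mem _
  · intro a ha
    unfold baseG baseP
    split_ifs
    · exact h1
    · have := C.mem_snd (i - (a : ZMod t) - 1)
      rwa [sub_add_cancel] at this
  · intro a ha
    unfold baseG baseP
    rw [if_neg (show ¬ a + 1 = 0 by omega)]
    split_ifs with c
    · subst c; simpa using h2
    · have := C.mem_fst (i - (a : ZMod t) - 1)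
      rw [Nat.cast_add, Nat.cast_one, ← sub_sub]
      exact this

theorem rho_base {H : Finset (Finset V)} {t : ℕ} [NeZero t]
    (C : BergeCycle H t) (u : V) (i : ZMod t) (f : Finset V) (v : V) :
    rho t (baseP C u i) (baseG C f i) v ≤ rC C v + 1 := by
  unfold rho rC
  set X := (range t).filter
    (fun k => v ∈ baseG C f i k ∧ v ≠ baseP C u i k ∧ v ≠ baseP C u i (k + 1)) with hX
  have h1 : X.card ≤ (X.erase 0).card + 1 := by
    have := pred_card_le_card_erase (s := X) (a := 0)
    omega
  refine h1.trans (Nat.add_le_add_right ?_ 1)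
  apply card_le_card_of_injOn (fun s : ℕ => i - (s : ZMod t) - 1)
  · intro s hs
    rw [mem_coe, mem_erase, hX, mem_filter] at hs
    obtain ⟨hs0, hst, g1, g2, g3⟩ := hs
    unfold baseG at g1
    unfold baseP at g2 g3
    rw [if_neg hs0] at g1 g2
    rw [if_neg (by omega)] at g3
    simp only [coe_filter, mem_univ, true_and, Set.mem_ofPred_eq]
    refine ⟨g1, ?_, ?_⟩
    · rw [Nat.cast_add, Nat.cast_one, ← sub_sub] at g3
      exact g3
    · rwa [sub_add_cancel]
  · intro a ha b hb hab
    rw [mem_coe, mem_erase, hX, mem_filter, mem_range] at ha hb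
    simp only at hab
    exact cast_inj' (t := t) (by omega) (by omega) (by omega) (by omega)
      (by linear_combination -hab)

theorem pair_path {H : Finset (Finset V)} (h3 : IsThreeGraph H) {t : ℕ} [NeZero t] (ht : 3 ≤ t)
    (C : BergeCycle H t) {u : V} (hu : u ∉ Set.range C.vtx) {U : Set (ZMod t)}
    (hU : Usable C u U) {i j : ZMod t} (hi : i ∈ U) (hj : j ∈ U) (hij : i ≠ j) :
    ∃ p g, BP H t p g ∧ p 0 = C.vtx j ∧ p t = C.vtx i ∧ g 0 = C.edge j ∧ g (t - 1) = C.edge i ∧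
      ∀ v, rho t p g v ≤ rC C v + 2 := by
  obtain ⟨_, hU2, hU3⟩ := hU
  obtain ⟨e, he, e', he', hne, h1, h2, h4, h5, h6, h7⟩ := hU3 i hi j hj hij
  have B := base_path h3 (by omega) C hu he h2 h4 h1
  set k := (i - j).val with hk
  have hkt : k < t := ZMod.val_lt _
  have hkc : (k : ZMod t) = i - j := by rw [hk]; exact ZMod.natCast_zmod_val _
  have hk0 : k ≠ 0 := by
    intro h
    rw [h, Nat.cast_zero] at hkc
    exact hij (sub_eq_zero.1 hkc.symm)
  have hk1 : k ≠ 1 := by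
    intro h
    rw [h, Nat.cast_one] at hkc
    exact (hU2 i hi j hj hij).2 (by linear_combination hkc)
  have hk2 : k ≠ t - 1 := by
    intro h
    have : (k : ZMod t) + 1 = 0 := by
      have : ((k + 1 : ℕ) : ZMod t) = 0 := by
        rw [h, show t - 1 + 1 = t by omega, ZMod.natCast_self]
      simpa using this
    exact (hU2 i hi j hj hij).1 (by linear_combination hkc - this)
  have hR := B.rot (k := k) hkt (h := e') he' (by
    intro l hl hlk
    unfold baseG
    split_ifs with c
    · exact hne.symm
    · rintro rfl
      rcases edge_idx h3 (by omega) C hu h6 h7 with h | h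
      · have : (l : ZMod t) = k := by linear_combination -h - hkc
        exact hlk (cast_inj' (by omega) (by omega) (by omega) (by omega) this)
      · apply h5
        rw [h]; congr 1; ring) (by simpa [baseP] using h6) (by
    unfold baseP
    rw [if_neg (by omega)]
    rw [Nat.cast_add, Nat.cast_one, hkc]
    convert h7 using 2
    ring)
  refine ⟨_, _, hR, ?_, ?_, ?_, ?_, ?_⟩
  · unfold rotP baseP
    rw [if_pos (by omega), if_neg (by omega), Nat.sub_zero, hkc]
    congr 1; ring
  · unfold rotP baseP
    rw [if_neg (by omega), if_neg (by omega), ZMod.natCast_self, sub_zero]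
  · unfold rotG baseG
    rw [if_pos (by omega), if_neg (by omega), Nat.sub_zero, Nat.cast_sub (by omega), hkc]
    congr 1; push_cast; ring
  · unfold rotG baseG
    rw [if_neg (by omega), if_neg (by omega), if_neg (by omega), Nat.cast_sub (by omega),
      ZMod.natCast_self]
    congr 1; push_cast; ring
  · intro v
    have := rho_rot t k (baseP C u i) (baseG C e i) e' hkt v
    have := rho_base C u i e v
    omega

theorem key {n : ℕ} (hn : 69 ≤ n)
    (hcard : Fintype.card V = n) {H : Finset (Finset V)} (h3 : IsThreeGraph H)
    (hOre : ∀ u v : V, u ≠ v → ¬ HAdj H u v →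
      n + 65 ≤ shadowDeg H u + shadowDeg H v)
    {t : ℕ} (C : BergeCycle H t)
    (hlong : ∀ (t' : ℕ) (C' : BergeCycle H t'), t' ≤ t)
    (ht : t = n - 1 ∨ t = n - 2)
    (u : V) (hu : u ∉ Set.range C.vtx)
    (U : Set (ZMod t)) (hU : Usable C u U) (hUcard : C.dC u ≤ 6 * U.ncard) : False := by
  classical
  have : NeZero t := ⟨by omega⟩
  have hN : IsEmpty (BergeCycle H (t + 1)) := ⟨fun C' => by have := hlong _ C'; omega⟩
  set S : Finset (ZMod t) := U.toFinset with hS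
  have hSU : ∀ i, i ∈ S ↔ i ∈ U := fun i => by rw [hS, Set.mem_toFinset]
  have hSc : U.ncard = S.card := Set.ncard_eq_toFinset_card' U
  rw [hSc] at hUcard
  -- degree of `u` is large
  have hdu : 67 ≤ shadowDeg H u := by
    by_cases hex : ∃ w, u ≠ w ∧ ¬ HAdj H u w
    · obtain ⟨w, hw, hwa⟩ := hex
      have h1 := hOre u w hw hwa
      have h2 : shadowDeg H w ≤ ((univ : Finset V) \ {u, w}).card := by
        unfold shadowDeg
        rw [← Set.ncard_coe_finset]
        apply Set.ncard_le_ncard _ (finite_toSet _)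
        intro v hv
        obtain ⟨hv1, e, he, hv2, hv3⟩ := hv
        simp only [mem_coe, mem_sdiff, mem_univ, true_and, mem_insert, mem_singleton, not_or]
        refine ⟨?_, hv1.symm⟩
        rintro rfl
        exact hwa ⟨hw, e, he, hv3, hv2⟩
      rw [card_sdiff_of_subset (subset_univ _), card_univ, hcard, card_pair hw] at h2
      omega
    · push Not at hex
      have h2 : ((univ : Finset V) \ {u}).card ≤ shadowDeg H u := by
        unfold shadowDeg
        rw [← Set.ncard_coe_finset]
        apply Set.ncard_le_ncard _ (Set.toFinite _)
        intro v hv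
        simp only [mem_coe, mem_sdiff, mem_univ, true_and, mem_singleton] at hv
        exact hex v (Ne.symm hv)
      rw [card_sdiff_of_subset (subset_univ _), card_univ, hcard, card_singleton] at h2
      omega
  have hdC : shadowDeg H u ≤ C.dC u + 1 := by
    have hr : ((univ : Finset (ZMod t)).image C.vtx).card = t := by
      rw [card_image_of_injective _ C.vtx_inj, card_univ, ZMod.card]
    have hins : (insert u ((univ : Finset (ZMod t)).image C.vtx)).card = t + 1 := by
      rw [card_insert_of_notMem, hr]
      intro h
      obtain ⟨a, _, ha⟩ := mem_image.1 h
      exact hu ⟨a, ha⟩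
    have hc : ((univ : Finset V) \ insert u ((univ : Finset (ZMod t)).image C.vtx)).card ≤ 1 := by
      rw [card_sdiff_of_subset (subset_univ _), card_univ, hcard, hins]
      omega
    have hsub : {v | HAdj H u v} ⊆ {v | v ∈ Set.range C.vtx ∧ HAdj H u v} ∪
        (((univ : Finset V) \ insert u ((univ : Finset (ZMod t)).image C.vtx) : Finset V) :
          Set V) := by
      intro v hv
      by_cases hvr : v ∈ Set.range C.vtx
      · left; exact ⟨hvr, hv⟩
      · right
        simp only [mem_coe, mem_sdiff, mem_univ, true_and, mem_insert, not_or, mem_image,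
          not_exists]
        exact ⟨hv.1.symm, fun a ha => hvr ⟨a, ha⟩⟩
    have h1 := Set.ncard_le_ncard hsub (Set.toFinite _)
    have h2 := Set.ncard_union_le {v | v ∈ Set.range C.vtx ∧ HAdj H u v}
      (((univ : Finset V) \ insert u ((univ : Finset (ZMod t)).image C.vtx) : Finset V) : Set V)
    rw [Set.ncard_coe_finset] at h2
    unfold shadowDeg BergeCycle.dC
    omega
  have hs11 : 11 ≤ S.card := by omega
  -- total of `rC`
  have hrC : ∀ T : Finset (ZMod t), ∑ i ∈ T, rC C (C.vtx i) ≤ t := by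
    intro T
    have := double_count T (univ : Finset (ZMod t))
      (fun i k => C.vtx i ∈ C.edge k ∧ C.vtx i ≠ C.vtx k ∧ C.vtx i ≠ C.vtx (k + 1)) (by
        rintro k _ i _ j _ ⟨a1, a2, a3⟩ ⟨b1, b2, b3⟩
        by_contra hne
        refine four_mem h3 (C.edge_mem k) a1 b1 (C.mem_fst k) (C.mem_snd k)
          (fun h => hne (C.vtx_inj h)) a2 a3 b2 b3 ?_
        intro h
        have h0 : (1 : ZMod t) = 0 := by
          have : k + 0 = k + 1 := by simpa using C.vtx_inj h
          exact (add_left_cancel this).symm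
        have : Fact (1 < t) := ⟨by omega⟩
        exact one_ne_zero h0)
    rw [card_univ, ZMod.card] at this
    exact this
  -- pairwise adjacent subsets are small
  have hclique : ∀ T : Finset (ZMod t), T ⊆ S →
      (∀ i ∈ T, ∀ j ∈ T, i ≠ j → HAdj H (C.vtx i) (C.vtx j)) → T.card ≤ 3 := by
    intro T hT hadj
    apply clique_bound T (fun i j => C.vtx j ∈ C.edge i)
    · intro i hi j hj hij
      obtain ⟨p, g, P, p0, pt, g0, gt, _⟩ := pair_path h3 (by omega) C hu hU
        ((hSU i).1 (hT hi)) ((hSU j).1 (hT hj)) hij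
      have := adj_ends h3 P (by omega) hN (by
        rw [p0, pt]; exact hadj j hj i hi hij.symm)
      rw [p0, pt, g0, gt] at this
      exact this.symm
    · intro i hi j hj k hk hij hik h1 h2
      have hUi := (hSU i).1 (hT hi)
      have n1 := (hU.2.1 i hUi j ((hSU j).1 (hT hj)) hij).1
      have n2 := (hU.2.1 i hUi k ((hSU k).1 (hT hk)) hik).1
      by_contra hjk
      refine four_mem h3 (C.edge_mem i) (C.mem_fst i) (C.mem_snd i) h1 h2 ?_
        (fun h => hij (C.vtx_inj h)) (fun h => hik (C.vtx_inj h))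
        (fun h => n1 (C.vtx_inj h).symm) (fun h => n2 (C.vtx_inj h).symm)
        (fun h => hjk (C.vtx_inj h))
      intro h
      have h0 : (1 : ZMod t) = 0 := by
        have : i + 0 = i + 1 := by simpa using C.vtx_inj h
        exact (add_left_cancel this).symm
      have : Fact (1 < t) := ⟨by omega⟩
      exact one_ne_zero h0
  -- step A
  have hA : 29 * (S.card - 3) ≤ t := by
    set T := S.filter (fun i => rC C (C.vtx i) < 29) with hT
    have hT3 : T.card ≤ 3 := by
      apply hclique T (filter_subset _ _)
      intro i hi j hj hij
      by_contra hna
      have hi' := mem_filter.1 hi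
      have hj' := mem_filter.1 hj
      obtain ⟨p, g, P, p0, pt, g0, gt, hrho⟩ := pair_path h3 (by omega) C hu hU
        ((hSU i).1 hi'.1) ((hSU j).1 hj'.1) hij
      have c := count_main h3 P (by omega) hN
      rw [p0, pt, hcard] at c
      have o := hOre _ _ (fun h => hij (C.vtx_inj h)) hna
      have r1 := hrho (C.vtx i)
      have r2 := hrho (C.vtx j)
      omega
    have hsum := hrC (S.filter (fun i => ¬ rC C (C.vtx i) < 29))
    have hlow := card_nsmul_le_sum (S.filter (fun i => ¬ rC C (C.vtx i) < 29))
      (fun i => rC C (C.vtx i)) 29 (fun i hi => by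
        have := (mem_filter.1 hi).2
        omega)
    have hsplit : T.card + (S.filter (fun i => ¬ rC C (C.vtx i) < 29)).card = S.card := by
      rw [hT]
      convert card_filter_add_card_filter_not (s := S) (fun i => rC C (C.vtx i) < 29)
    rw [smul_eq_mul] at hlow
    omega
  -- step B: choose good `i`, `j`
  have hB : ∃ i ∈ S, ∃ j ∈ S, i ≠ j ∧ (n + 65 ≤ 2 * shadowDeg H (C.vtx i) ∧
      7 * rC C (C.vtx i) ≤ t) ∧ (n + 65 ≤ 2 * shadowDeg H (C.vtx j) ∧
      7 * rC C (C.vtx j) ≤ t) := by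
    have b1 : (S.filter (fun i => ¬ n + 65 ≤ 2 * shadowDeg H (C.vtx i))).card ≤ 3 := by
      apply hclique _ (filter_subset _ _)
      intro i hi j hj hij
      by_contra hna
      have hi' := (mem_filter.1 hi).2
      have hj' := (mem_filter.1 hj).2
      have o := hOre _ _ (fun h => hij (C.vtx_inj h)) hna
      omega
    have b2 := card_filter_add_card_filter_not (s := S)
      (fun i => n + 65 ≤ 2 * shadowDeg H (C.vtx i))
    set T := S.filter (fun i => n + 65 ≤ 2 * shadowDeg H (C.vtx i)) with hT
    have b3 := card_filter_add_card_filter_not (s := T) (fun i => 7 * rC C (C.vtx i) ≤ t)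
    have b4 : (T.filter (fun i => ¬ 7 * rC C (C.vtx i) ≤ t)).card ≤ 6 := by
      by_contra hcon
      have hsum := hrC (T.filter (fun i => ¬ 7 * rC C (C.vtx i) ≤ t))
      have hlow := card_nsmul_le_sum (T.filter (fun i => ¬ 7 * rC C (C.vtx i) ≤ t))
        (fun i => rC C (C.vtx i)) (t / 7 + 1) (fun i hi => by
          have := (mem_filter.1 hi).2
          omega)
      rw [smul_eq_mul] at hlow
      have : 7 * (t / 7 + 1) ≤
          (T.filter (fun i => ¬ 7 * rC C (C.vtx i) ≤ t)).card * (t / 7 + 1) :=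
        Nat.mul_le_mul_right _ (by omega)
      omega
    have b5 : 1 < (T.filter (fun i => 7 * rC C (C.vtx i) ≤ t)).card := by omega
    obtain ⟨i, hi, j, hj, hij⟩ := one_lt_card.1 b5
    have i1 := mem_filter.1 hi
    have j1 := mem_filter.1 hj
    have i2 := mem_filter.1 i1.1
    have j2 := mem_filter.1 j1.1
    exact ⟨i, i2.1, j, j2.1, hij, ⟨i2.2, i1.2⟩, ⟨j2.2, j1.2⟩⟩
  obtain ⟨i, hi, j, hj, hij, ⟨hi1, hi2⟩, ⟨hj1, hj2⟩⟩ := hB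
  obtain ⟨p, g, P, p0, pt, g0, gt, hrho⟩ := pair_path h3 (by omega) C hu hU
    ((hSU i).1 hi) ((hSU j).1 hj) hij
  have cA := count_A h3 P (by omega)
  rw [p0, hcard] at cA
  have rj := hrho (C.vtx j)
  have ri := hrho (C.vtx i)
  have hlt : ∀ k ∈ Aset H t p g, k < t := fun k hk => mem_range.1 (mem_filter.1 hk).1
  set Z := (Aset H t p g).filter (fun k => u ≠ p k ∧ ¬ HAdj H u (p k)) with hZ
  have hZc : (Aset H t p g).card ≤ Z.card + shadowDeg H u + 1 := by
    have s1 : Z.card + ((Aset H t p g).filter (fun k => ¬ (u ≠ p k ∧ ¬ HAdj H u (p k)))).card =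
        (Aset H t p g).card := by
      rw [hZ]
      convert card_filter_add_card_filter_not (s := Aset H t p g)
        (fun k => u ≠ p k ∧ ¬ HAdj H u (p k))
    have s2 : ((Aset H t p g).filter (fun k => ¬ (u ≠ p k ∧ ¬ HAdj H u (p k)))).card ≤
        (insert u ({v | HAdj H u v} : Set V).toFinset).card := by
      apply card_le_card_of_injOn p
      · intro k hk
        have hk' := (mem_filter.1 hk).2
        simp only [coe_insert, Set.coe_toFinset, Set.mem_insert_iff, Set.mem_ofPred_eq]
        by_cases hc : u = p k
        · left; exact hc.symm
        · right
          by_contra hc2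
          exact hk' ⟨hc, hc2⟩
      · intro a ha b hb hab
        have := hlt a (mem_filter.1 ha).1
        have := hlt b (mem_filter.1 hb).1
        exact P.pinj _ _ (by omega) (by omega) hab
    have s4 := card_insert_le u ({v | HAdj H u v} : Set V).toFinset
    have s5 : shadowDeg H u = ({v | HAdj H u v} : Set V).toFinset.card :=
      Set.ncard_eq_toFinset_card' _
    omega
  have hZsum : ∑ k ∈ Z, rho t p g (p k) ≤ t := by
    have := double_count Z (range t)
      (fun k l => p k ∈ g l ∧ p k ≠ p l ∧ p k ≠ p (l + 1)) (by
        rintro l hl a ha b hb ⟨a1, a2, a3⟩ ⟨b1, b2, b3⟩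
        have hl' := mem_range.1 hl
        have ha' := hlt a (mem_filter.1 ha).1
        have hb' := hlt b (mem_filter.1 hb).1
        by_contra hne
        refine four_mem h3 (P.gm l hl') a1 b1 (P.m1 l hl') (P.m2 l hl')
          (fun h => hne (P.pinj _ _ (by omega) (by omega) h)) a2 a3 b2 b3 ?_
        intro h
        have := P.pinj _ _ (by omega) (by omega) h
        omega)
    rw [card_range] at this
    exact this
  have hZ9 : 9 ≤ Z.card := by omega
  have hw : ∃ k ∈ Z, 9 * rho t p g (p k) ≤ t := by
    by_contra hcon
    push Not at hcon
    have hlow := card_nsmul_le_sum Z (fun k => rho t p g (p k)) (t / 9 + 1) (fun k hk => by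
      have := hcon k hk
      omega)
    rw [smul_eq_mul] at hlow
    have : 9 * (t / 9 + 1) ≤ Z.card * (t / 9 + 1) := Nat.mul_le_mul_right _ hZ9
    omega
  obtain ⟨k, hk, hkr⟩ := hw
  obtain ⟨hkA, hku, hkn⟩ := mem_filter.1 hk
  obtain ⟨hkt, h, hH, hx, hk1, hg⟩ := mem_filter.1 hkA
  rw [mem_range] at hkt
  have Q := P.rot hkt hH hg hx hk1
  have cQ := count_main h3 Q (by omega) hN
  have q0 : rotP k p 0 = p k := by simp [rotP]
  have qt : rotP k p t = C.vtx i := by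
    simp only [rotP, show ¬ t ≤ k by omega, if_false]; exact pt
  rw [q0, qt, hcard] at cQ
  have e1 := rho_rot t k p g h hkt (p k)
  have e2 := rho_rot t k p g h hkt (C.vtx i)
  have o := hOre u (p k) hku hkn
  omega

end Aux

/-- Claim 10: for distinct `v_{i+1}, v_{j+1}` in
`X = {v_{i+1} : v_i ∈ U_u ∩ B₁(C)}`,
`|R(v_{i+1}, v_{j+1})| ≥ d_C(v_{i+1}) + d_C(v_{j+1}) - |V(C)| - 6`. -/
theorem stmt18 {V : Type*} [Fintype V] [DecidableEq V] (n : ℕ) (hn : 69 ≤ n)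
    (hcard : Fintype.card V = n) (H : Finset (Finset V)) (h3 : IsThreeGraph H)
    (hOre : ∀ u v : V, u ≠ v → ¬ HAdj H u v →
      n + 65 ≤ shadowDeg H u + shadowDeg H v)
    (hnoham : ¬ HamiltonianBergeCycle H)
    {t : ℕ} (C : BergeCycle H t)
    (hlong : ∀ (t' : ℕ) (C' : BergeCycle H t'), t' ≤ t)
    (ht : t = n - 1 ∨ t = n - 2)
    (u : V) (hu : u ∉ Set.range C.vtx)
    (U : Set (ZMod t)) (hU : Usable C u U) (hUcard : (C.dC u : ℚ) / 6 ≤ U.ncard)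
    (i j : ZMod t) (hi : i ∈ U) (hj : j ∈ U) (hij : i ≠ j)
    (hiB1 : (n + 65 : ℚ) / 2 - 3 ≤ (C.dC (C.vtx i) : ℚ) ∧
      (C.dC (C.vtx i) : ℚ) < 3 * (n : ℚ) / 4 + 13)
    (hjB1 : (n + 65 : ℚ) / 2 - 3 ≤ (C.dC (C.vtx j) : ℚ) ∧
      (C.dC (C.vtx j) : ℚ) < 3 * (n : ℚ) / 4 + 13) :
    (C.dC (C.vtx (i + 1)) : ℤ) + (C.dC (C.vtx (j + 1)) : ℤ)
        - ((Set.range C.vtx).ncard : ℤ) - 6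
      ≤ ((RBridges C (i + 1) (j + 1)).ncard : ℤ) := by
  exfalso
  refine key hn hcard h3 hOre C hlong ht u hu U hU ?_
  have h : (C.dC u : ℚ) ≤ 6 * (U.ncard : ℚ) := by linarith
  exact_mod_cast h
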